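/- Let σ'_0 be a finite-memory winning strategy for Player 0 with memory domain M on her winning region of the reduced two-player game G', let G'×M be the product of G' with M with Player-0 moves restricted according to σ'_0, and let G×M be the corresponding product of the SAS game G with Player-0 choices fixed by the strategy σ_0 induced from σ'_0 (via the gadget structure). Then every good parity ranking (with respect to p'_as) of G'×M induces an almost-sure ranking (with respect to p_as) of G×M, taking ε to be the minimal probability of a transition in G. -/

import Mathlib

open MeasureTheory

/-- The set of elements occurring infinitely often in an infinite sequence. -/
def InfOcc {α : Type*} (s : ℕ → α) : Set α := {v | ∀ n, ∃ m, n ≤ m ∧ s m = v}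

/-- The minimal priority occurring infinitely often. -/
noncomputable def minPrio {α : Type*} (p : α → ℕ) (s : ℕ → α) : ℕ := sInf (p '' InfOcc s)

/-- The parity condition induced by a priority function. -/
def ParityWin {α : Type*} (p : α → ℕ) : Set (ℕ → α) := {s | Even (minPrio p s)}

/-- The history of a play up to (excluding) time `n`. -/
def hist {α : Type*} (p : ℕ → α) (n : ℕ) : List α := (List.range n).map p

/-- A finite stochastic game graph together with two priority functions:
`ps` inducing the sure parity condition and `pas` inducing the almost-sure one. -/
structure SASGame (V : Type) [Fintype V] where
  V0 : Set V
  V1 : Set V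
  Vp : Set V
  cover : V0 ∪ V1 ∪ Vp = Set.univ
  disj01 : Disjoint V0 V1
  disj0p : Disjoint V0 Vp
  disj1p : Disjoint V1 Vp
  E : V → V → Prop
  succ_nonempty : ∀ v, ∃ w, E v w
  κ : V → V → ENNReal
  κ_pos : ∀ v ∈ Vp, ∀ w, (0 < κ v w ↔ E v w)
  κ_sum : ∀ v ∈ Vp, ∑ w, κ v w = 1
  ps : V → ℕ
  pas : V → ℕ

variable {V : Type} [Fintype V]

/-- A strategy: given the past history and the current configuration, choose a successor. -/
abbrev Strat (V : Type) := List V → V → V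

/-- A valid Player-0 strategy respects the edge relation on Player-0 configurations. -/
def SASGame.Valid0 (G : SASGame V) (σ : Strat V) : Prop := ∀ h v, v ∈ G.V0 → G.E v (σ h v)

/-- A valid Player-1 strategy respects the edge relation on Player-1 configurations. -/
def SASGame.Valid1 (G : SASGame V) (π : Strat V) : Prop := ∀ h v, v ∈ G.V1 → G.E v (π h v)

/-- A strategy is memoryless if it only depends on the current configuration. -/
def Memoryless {V : Type} (σ : Strat V) : Prop := ∀ h h' v, σ h v = σ h' v

/-- `v(σ)`: the plays from `v` consistent with the Player-0 strategy `σ`. -/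
def SASGame.PlaysFrom (G : SASGame V) (v : V) (σ : Strat V) : Set (ℕ → V) :=
  {p | p 0 = v ∧ (∀ n, G.E (p n) (p (n + 1))) ∧
    ∀ n, p n ∈ G.V0 → p (n + 1) = σ (hist p n) (p n)}

/-- The plays from `v` consistent with both strategies `σ` and `π`. -/
def SASGame.Plays2 (G : SASGame V) (v : V) (σ π : Strat V) : Set (ℕ → V) :=
  {p | p ∈ G.PlaysFrom v σ ∧ ∀ n, p n ∈ G.V1 → p (n + 1) = π (hist p n) (p n)}

open Classical in
/-- One-step transition probability of the Markov chain `v(σ,π)`. -/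
noncomputable def SASGame.step (G : SASGame V) (σ π : Strat V)
    (past : List V) (cur nxt : V) : ENNReal :=
  if cur ∈ G.V0 then (if nxt = σ past cur then 1 else 0)
  else if cur ∈ G.V1 then (if nxt = π past cur then 1 else 0)
  else G.κ cur nxt

open Classical in
/-- Probability of the cylinder determined by the first `n+1` configurations of `h`. -/
noncomputable def SASGame.cylProb (G : SASGame V) (v : V) (σ π : Strat V)
    (h : ℕ → V) (n : ℕ) : ENNReal :=
  (if h 0 = v then 1 else 0) * ∏ i ∈ Finset.range n, G.step σ π (hist h i) (h i) (h (i + 1))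

/-- The product σ-algebra on plays. -/
def playMS (V : Type) : MeasurableSpace (ℕ → V) :=
  @MeasurableSpace.pi ℕ (fun _ => V) (fun _ => ⊤)

/-- `μ` is the probability measure of the Markov chain `v(σ,π)`: it is the (unique)
probability measure on plays assigning to every cylinder the product of the
transition probabilities along it. -/
def SASGame.IsPlayMeasure (G : SASGame V) (v : V) (σ π : Strat V)
    (μ : @Measure (ℕ → V) (playMS V)) : Prop :=
  μ Set.univ = 1 ∧
    ∀ (h : ℕ → V) (n : ℕ), μ {p | ∀ i ≤ n, p i = h i} = G.cylProb v σ π h n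

/-- Player 0 wins from `v` with strategy `σ`. -/
def SASGame.Wins0Via (G : SASGame V) (v : V) (σ : Strat V) : Prop :=
  G.Valid0 σ ∧ G.PlaysFrom v σ ⊆ ParityWin G.ps ∧
    ∀ π, G.Valid1 π → ∀ μ, G.IsPlayMeasure v σ π μ → μ (ParityWin G.pas) = 1

/-- Player 0 wins from `v`: she has a strategy `σ` such that all plays consistent with
`σ` satisfy the sure parity condition and, against every Player-1 strategy, the
almost-sure parity condition holds with probability 1. -/
def SASGame.Wins0 (G : SASGame V) (v : V) : Prop := ∃ σ, G.Wins0Via v σ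

/-- Player 1 wins from `v` with strategy `π`. -/
def SASGame.Wins1Via (G : SASGame V) (v : V) (π : Strat V) : Prop :=
  G.Valid1 π ∧ ∀ σ, G.Valid0 σ →
    (∃ p ∈ G.Plays2 v σ π, p ∉ ParityWin G.ps) ∨
    (∀ μ, G.IsPlayMeasure v σ π μ → μ (ParityWin G.pas) < 1)

/-- Player 1 wins from `v`. -/
def SASGame.Wins1 (G : SASGame V) (v : V) : Prop := ∃ π, G.Wins1Via v π

/-! ### The reduced two-player game `G'` obtained by replacing probabilistic
configurations by gadgets. -/

/-- Configurations of the reduced game: original configurations `base v`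
(for `v ∈ V0 ∪ V1`), and for each probabilistic `v` the gadget configurations
`bar v` (= v̄), `tilde v k` (= (ṽ,k) for even `k`) and `hat v j` (= (v̂,j)). -/
inductive GVert (V : Type) where
  | base : V → GVert V
  | bar : V → GVert V
  | tilde : V → ℕ → GVert V
  | hat : V → ℕ → GVert V
deriving DecidableEq

open Classical in
/-- A successor `w` of `G` is represented in `G'` by `bar w` if `w` is
probabilistic and by `base w` otherwise. -/
noncomputable def GLift (G : SASGame V) (w : V) : GVert V :=
  if w ∈ G.Vp then GVert.bar w else GVert.base w

/-- The configuration of `G` a configuration of `G'` belongs to. -/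
def GVert.unlift {V : Type} : GVert V → V
  | .base v => v
  | .bar v => v
  | .tilde v _ => v
  | .hat v _ => v

/-- The configurations of the reduced game `G'`. -/
def GValid (G : SASGame V) : GVert V → Prop
  | .base v => v ∈ G.V0 ∪ G.V1
  | .bar v => v ∈ G.Vp
  | .tilde v k => v ∈ G.Vp ∧ Even k ∧ k ≤ G.pas v + 1
  | .hat v j => v ∈ G.Vp ∧ j ≤ G.pas v

/-- The edge relation of the reduced game `G'`: edges among `V0 ∪ V1` remain
(redirected to `bar w` when `w ∈ Vp`), `bar v` moves to the `tilde v k`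
(even `k ∈ [0..pas v + 1]`), `tilde v k` moves to `hat v k` (when `k ≤ pas v`)
or to `hat v (k-1)` (when `k - 1 ≥ 1`), and `hat v j` moves to the successors
of `v` in `G`. -/
def GEdge (G : SASGame V) : GVert V → GVert V → Prop
  | .base v, y => (v ∈ G.V0 ∪ G.V1) ∧ ∃ w, G.E v w ∧ y = GLift G w
  | .bar v, y => v ∈ G.Vp ∧ ∃ k, Even k ∧ k ≤ G.pas v + 1 ∧ y = GVert.tilde v k
  | .tilde v k, y => v ∈ G.Vp ∧ Even k ∧ k ≤ G.pas v + 1 ∧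
      ((y = GVert.hat v k ∧ k ≤ G.pas v) ∨ (y = GVert.hat v (k - 1) ∧ 1 ≤ k - 1))
  | .hat v j, y => v ∈ G.Vp ∧ j ≤ G.pas v ∧ ∃ w, G.E v w ∧ y = GLift G w

/-- Player-0 configurations of the reduced game `G'`: `base v` with `v ∈ V0`,
all `tilde` configurations, and `hat v j` for odd `j`. -/
def GP0 (G : SASGame V) : GVert V → Prop
  | .base v => v ∈ G.V0
  | .bar _ => False
  | .tilde _ _ => True
  | .hat _ j => Odd j

/-- The almost-sure priority function `p'_as` of `G'`. -/
def GPas (G : SASGame V) : GVert V → ℕ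
  | .base v => G.pas v
  | .bar v => G.pas v
  | .tilde v _ => G.pas v
  | .hat _ j => j

/-- The sure priority function `p'_s` of `G'`. -/
def GPs (G : SASGame V) : GVert V → ℕ
  | .base v => G.ps v
  | .bar v => G.ps v
  | .tilde v _ => G.ps v
  | .hat v _ => G.ps v

/-- Player 0 sure-wins the two-player game `G'` from `x` for the winning
condition given by the intersection of the two parity conditions induced by
`p'_s` and `p'_as`. -/
def GSureWin (G : SASGame V) (x : GVert V) : Prop :=
  ∃ σ' : List (GVert V) → GVert V → GVert V,
    (∀ h y, GP0 G y → (∃ z, GEdge G y z) → GEdge G y (σ' h y)) ∧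
    ∀ p : ℕ → GVert V, p 0 = x → (∀ n, GEdge G (p n) (p (n + 1))) →
      (∀ n, GP0 G (p n) → p (n + 1) = σ' (hist p n) (p n)) →
      p ∈ ParityWin (GPs G) ∧ p ∈ ParityWin (GPas G)

/-- A strategy has finite memory if it is computed by a finite-state transducer
over histories. -/
def FiniteMemory {V : Type} (σ : Strat V) : Prop :=
  ∃ (M : Type) (_ : Fintype M) (m0 : M) (upd : M → V → M) (out : M → V → V),
    ∀ h v, σ h v = out (h.foldl upd m0) v

/-- Player 0 wins the SAS game from `v` with a finite-memory strategy. -/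
def SASGame.FinWins0 (G : SASGame V) (v : V) : Prop :=
  ∃ σ, FiniteMemory σ ∧ G.Wins0Via v σ

/-! ### Rankings -/

/-- The prefix `(a 1, a 3, …, a k̲)` of the odd-indexed components of a ranking
value, where `k̲ = k` if `k` is odd and `k̲ = k - 1` otherwise. -/
def rkPref (a : ℕ → ℕ) (k : ℕ) : List ℕ := (List.range ((k + 1) / 2)).map (fun i => a (2 * i + 1))

/-- Strict lexicographic comparison `<_k` of ranking values (with `none` = ∞). -/
def rkLt (k : ℕ) : Option (ℕ → ℕ) → Option (ℕ → ℕ) → Prop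
  | some a, some b => List.Lex (· < ·) (rkPref a k) (rkPref b k)
  | some _, none => True
  | none, _ => False

/-- Lexicographic comparison `≤_k` of ranking values (with `none` = ∞). -/
def rkLe (k : ℕ) : Option (ℕ → ℕ) → Option (ℕ → ℕ) → Prop
  | some a, some b => rkPref a k = rkPref b k ∨ List.Lex (· < ·) (rkPref a k) (rkPref b k)
  | some _, none => True
  | none, some _ => False
  | none, none => True

/-- A good parity ranking on a two-player game graph with edges `R`, Player-0
vertices `P0` and priority function `pr`: every Player-0 vertex with non-∞ rank
has a successor whose rank does not increase (`≤_{pr v}`), strictly (`<_{pr v}`)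
if its priority is odd, and every successor of such a Player-1 vertex does not
increase the rank, strictly if its priority is odd. -/
def IsGoodRanking {α : Type*} (R : α → α → Prop) (P0 : α → Prop) (pr : α → ℕ)
    (r : α → Option (ℕ → ℕ)) : Prop :=
  ∀ x, r x ≠ none →
    (P0 x → ∃ y, R x y ∧ rkLe (pr x) (r y) (r x) ∧ (Odd (pr x) → rkLt (pr x) (r y) (r x))) ∧
    (¬ P0 x → ∀ y, R x y → rkLe (pr x) (r y) (r x) ∧ (Odd (pr x) → rkLt (pr x) (r y) (r x)))

variable {M : Type} [Fintype M]

open Classical in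
/-- `Prob_{(v,m)}(r⃗_{≤_k})`: the probability of the successors `w` of the
probabilistic configuration `v` whose (memory-updated) rank satisfies
`r⃗(w, mem w) ≤_k r⃗(v, m)`. -/
noncomputable def probLe (G : SASGame V) (r : V × M → Option (ℕ → ℕ))
    (mem : V × M → V → M) (x : V × M) (k : ℕ) : ENNReal :=
  ∑ w ∈ Finset.univ.filter (fun w => G.E x.1 w ∧ rkLe k (r (w, mem x w)) (r x)), G.κ x.1 w

open Classical in
/-- `Prob_{(v,m)}(r⃗_{<_k})`. -/
noncomputable def probLt (G : SASGame V) (r : V × M → Option (ℕ → ℕ))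
    (mem : V × M → V → M) (x : V × M) (k : ℕ) : ENNReal :=
  ∑ w ∈ Finset.univ.filter (fun w => G.E x.1 w ∧ rkLt k (r (w, mem x w)) (r x)), G.κ x.1 w

/-- An almost-sure ranking (with witness `ε`) of the product `G × M`, where Player-0
moves are fixed by `succ0`, and `mem1` (resp. `memp`) gives the memory update on
successors of Player-1 (resp. probabilistic) configurations. -/
def IsASRanking (G : SASGame V) (succ0 : V × M → V × M → Prop)
    (mem1 memp : V × M → V → M) (r : V × M → Option (ℕ → ℕ)) (ε : ENNReal) : Prop :=
  ∀ x : V × M, r x ≠ none →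
    (x.1 ∈ G.V0 → ∃ y, succ0 x y ∧ rkLe (G.pas x.1) (r y) (r x) ∧
      (Odd (G.pas x.1) → rkLt (G.pas x.1) (r y) (r x))) ∧
    (x.1 ∈ G.V1 → ∀ w, G.E x.1 w → rkLe (G.pas x.1) (r (w, mem1 x w)) (r x) ∧
      (Odd (G.pas x.1) → rkLt (G.pas x.1) (r (w, mem1 x w)) (r x))) ∧
    (x.1 ∈ G.Vp → Even (G.pas x.1) →
      (probLe G r memp x (G.pas x.1 - 1) = 1 ∨
        ∃ j, Odd j ∧ j ≤ G.pas x.1 ∧ probLe G r memp x (j - 2) = 1 ∧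
          ε ≤ probLt G r memp x j)) ∧
    (x.1 ∈ G.Vp → Odd (G.pas x.1) →
      ∃ j, Odd j ∧ j ≤ G.pas x.1 ∧ probLe G r memp x (j - 2) = 1 ∧
        ε ≤ probLt G r memp x j)

/-- The minimal probability of a (probabilistic) transition in `G`. -/
noncomputable def minTransProb (G : SASGame V) : ENNReal :=
  ⨅ (v : V) (_ : v ∈ G.Vp) (w : V) (_ : G.E v w), G.κ v w

open Classical in
/-- The product `G' × M`: Player-0 moves are restricted according to the
finite-memory strategy given by the (move and memory) choice function `s`, and
the memory is updated by `u` on moves of Player 1. -/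
noncomputable def GProdEdge (G : SASGame V) (s : GVert V × M → GVert V × M)
    (u : GVert V × M → GVert V → M) :
    GVert V × M → GVert V × M → Prop :=
  fun x y => GEdge G x.1 y.1 ∧ (if GP0 G x.1 then y = s x else y.2 = u x y.1)

open Classical in
/-- The memory value attached to the successor `w` of a probabilistic
configuration `(v, m)` of `G × M` in the strategy induced via the gadget
structure: if some (minimal) `i ≥ 1` is such that the choice of the strategy
from `(ṽ, 2i)` is `(v̂, 2i-1)`, the chosen successor `w₀` of `(v̂, 2i₀-1)`
receives the memory reached along the path `v̄, (ṽ,2i₀), (v̂,2i₀-1), w₀`, and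
every other `w` the memory reached along `v̄, (ṽ,2i₀-2), (v̂,2i₀-2), w`;
otherwise `w` receives the memory reached along `v̄, (ṽ,p_as(v)), (v̂,p_as(v)), w`. -/
noncomputable def vpMem (G : SASGame V) (s : GVert V × M → GVert V × M)
    (u : GVert V × M → GVert V → M) (x : V × M) (w : V) : M :=
  let v := x.1
  let m := x.2
  let p := G.pas v
  let mt : ℕ → M := fun k => u (GVert.bar v, m) (GVert.tilde v k)
  if h : ∃ i, 1 ≤ i ∧ 2 * i ≤ p + 1 ∧
      (s (GVert.tilde v (2 * i), mt (2 * i))).1 = GVert.hat v (2 * i - 1) then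
    let i0 := Nat.find h
    let c := s (GVert.hat v (2 * i0 - 1), (s (GVert.tilde v (2 * i0), mt (2 * i0))).2)
    if c.1 = GLift G w then c.2
    else u (GVert.hat v (2 * i0 - 2),
      (s (GVert.tilde v (2 * i0 - 2), mt (2 * i0 - 2))).2) (GLift G w)
  else
    u (GVert.hat v p, (s (GVert.tilde v p, mt p)).2) (GLift G w)

/-- The move of the induced strategy `σ₀` from a Player-0 configuration of `G × M`. -/
noncomputable def succ0of (G : SASGame V) (s : GVert V × M → GVert V × M) :
    V × M → V × M → Prop :=
  fun x y => y = ((s (GVert.base x.1, x.2)).1.unlift, (s (GVert.base x.1, x.2)).2)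

/-- The memory update of the induced strategy on successors of Player-1
configurations of `G × M`. -/
noncomputable def mem1of (G : SASGame V) (u : GVert V × M → GVert V → M) :
    V × M → V → M :=
  fun x w => u (GVert.base x.1, x.2) (GLift G w)

theorem List.Lex.take_eq_or_lex {α : Type*} {R : α → α → Prop} {l₁ l₂ : List α}
    (h : List.Lex R l₁ l₂) (hlen : l₁.length = l₂.length) (n : ℕ) :
    l₁.take n = l₂.take n ∨ List.Lex R (l₁.take n) (l₂.take n) := by
  induction h generalizing n with
  | nil => simp at hlen
  | @cons a l₁ l₂ _ ih =>
    cases n with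
    | zero => simp
    | succ n =>
      rcases ih (by simpa using hlen) n with h | h
      · left; simp [h]
      · right; simpa using List.Lex.cons h
  | rel h =>
    cases n with
    | zero => simp
    | succ n => right; simpa using List.Lex.rel h

theorem List.Lex.trans_lt {l₁ l₂ l₃ : List ℕ} (h₁ : List.Lex (· < ·) l₁ l₂)
    (h₂ : List.Lex (· < ·) l₂ l₃) : List.Lex (· < ·) l₁ l₃ := by
  change l₁ < l₃
  exact lt_trans (show l₁ < l₂ from h₁) (show l₂ < l₃ from h₂)

theorem rkPref_take (a : ℕ → ℕ) {k l : ℕ} (h : (k + 1) / 2 ≤ (l + 1) / 2) :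
    rkPref a k = (rkPref a l).take ((k + 1) / 2) := by
  simp [rkPref, ← List.map_take, List.take_range, Nat.min_eq_left h]

theorem rkLe_of_rkLt {k : ℕ} {x y : Option (ℕ → ℕ)} (h : rkLt k x y) : rkLe k x y := by
  cases x <;> cases y <;> simp_all [rkLe, rkLt]

theorem rkLe_trans {k : ℕ} {x y z : Option (ℕ → ℕ)} (h₁ : rkLe k x y) (h₂ : rkLe k y z) :
    rkLe k x z := by
  cases x <;> cases y <;> cases z <;> simp only [rkLe] at h₁ h₂ ⊢
  rcases h₁ with h₁ | h₁
  · rw [h₁]; exact h₂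
  · rcases h₂ with h₂ | h₂
    · rw [← h₂]; exact Or.inr h₁
    · exact Or.inr (h₁.trans_lt h₂)

theorem rkLt_of_rkLt_of_rkLe {k : ℕ} {x y z : Option (ℕ → ℕ)} (h₁ : rkLt k x y)
    (h₂ : rkLe k y z) : rkLt k x z := by
  cases x <;> cases y <;> cases z <;> simp only [rkLe, rkLt] at h₁ h₂ ⊢
  rcases h₂ with h₂ | h₂
  · rw [← h₂]; exact h₁
  · exact h₁.trans_lt h₂

theorem rkLe_mono {k l : ℕ} (hkl : (k + 1) / 2 ≤ (l + 1) / 2) {x y : Option (ℕ → ℕ)}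
    (h : rkLe l x y) : rkLe k x y := by
  cases x <;> cases y <;> simp only [rkLe] at h ⊢
  rw [rkPref_take _ hkl, rkPref_take _ hkl]
  rcases h with h | h
  · rw [h]; exact Or.inl rfl
  · exact h.take_eq_or_lex (by simp [rkPref]) _

theorem ne_none_of_rkLe {k : ℕ} {x y : Option (ℕ → ℕ)} (h : rkLe k x y) (hy : y ≠ none) :
    x ≠ none := by
  cases x <;> cases y <;> simp_all [rkLe]

theorem GLift_of_mem {G : SASGame V} {v : V} (h : v ∈ G.Vp) : GLift G v = GVert.bar v := by
  simp [GLift, h]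

theorem GLift_of_notMem {G : SASGame V} {v : V} (h : v ∉ G.Vp) : GLift G v = GVert.base v := by
  simp [GLift, h]

theorem unlift_GLift (G : SASGame V) (v : V) : (GLift G v).unlift = v := by
  unfold GLift; split_ifs <;> rfl

theorem probLe_eq_one {G : SASGame V} {r : V × M → Option (ℕ → ℕ)} {mem : V × M → V → M}
    {x : V × M} {k : ℕ} (hx : x.1 ∈ G.Vp)
    (h : ∀ w, G.E x.1 w → rkLe k (r (w, mem x w)) (r x)) : probLe G r mem x k = 1 := by
  classical
  rw [probLe, ← G.κ_sum x.1 hx]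
  refine Finset.sum_subset (Finset.filter_subset _ _) fun w _ hw => ?_
  have hE : ¬ G.E x.1 w := fun hE => hw (by simp [hE, h w hE])
  rw [← G.κ_pos x.1 hx w] at hE
  simpa using hE

theorem minTransProb_le_probLt {G : SASGame V} {r : V × M → Option (ℕ → ℕ)}
    {mem : V × M → V → M} {x : V × M} {k : ℕ} (hx : x.1 ∈ G.Vp) {w : V} (hE : G.E x.1 w)
    (h : rkLt k (r (w, mem x w)) (r x)) : minTransProb G ≤ probLt G r mem x k := by
  classical
  calc minTransProb G ≤ G.κ x.1 w :=
        iInf_le_of_le x.1 <| iInf_le_of_le hx <| iInf_le_of_le w <| iInf_le _ hE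
    _ ≤ probLt G r mem x k := by
        unfold probLt
        exact Finset.single_le_sum (f := fun w => G.κ x.1 w) (fun _ _ => zero_le)
          (by simp [hE, h])

section GoodRanking

variable {G : SASGame V} {s : GVert V × M → GVert V × M} {u : GVert V × M → GVert V → M}
  {r' : GVert V × M → Option (ℕ → ℕ)}

theorem IsGoodRanking.of_P0 (hr' : IsGoodRanking (GProdEdge G s u) (fun x => GP0 G x.1)
      (fun x => GPas G x.1) r') {x : GVert V × M} (hx : r' x ≠ none) (h0 : GP0 G x.1) :
    GEdge G x.1 (s x).1 ∧ rkLe (GPas G x.1) (r' (s x)) (r' x) ∧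
      (Odd (GPas G x.1) → rkLt (GPas G x.1) (r' (s x)) (r' x)) := by
  obtain ⟨y, ⟨hE, hy⟩, h⟩ := (hr' x hx).1 h0
  rw [if_pos h0] at hy
  subst hy
  exact ⟨hE, h⟩

theorem IsGoodRanking.of_P1 (hr' : IsGoodRanking (GProdEdge G s u) (fun x => GP0 G x.1)
      (fun x => GPas G x.1) r') {x : GVert V × M} (hx : r' x ≠ none) (h0 : ¬ GP0 G x.1)
    {y : GVert V} (hE : GEdge G x.1 y) :
    rkLe (GPas G x.1) (r' (y, u x y)) (r' x) ∧
      (Odd (GPas G x.1) → rkLt (GPas G x.1) (r' (y, u x y)) (r' x)) :=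
  (hr' x hx).2 h0 _ ⟨hE, by rw [if_neg h0]⟩

/-- The rank does not increase along the path from `v̄` through `(ṽ,k)` to the chosen `(v̂,j)`. -/
theorem IsGoodRanking.tilde (hr' : IsGoodRanking (GProdEdge G s u) (fun x => GP0 G x.1)
      (fun x => GPas G x.1) r') {v : V} {m : M} (hx : r' (GVert.bar v, m) ≠ none)
    (hv : v ∈ G.Vp) {k : ℕ} (hk : Even k) (hkp : k ≤ G.pas v + 1) :
    let y := s (GVert.tilde v k, u (GVert.bar v, m) (GVert.tilde v k))
    ((y.1 = GVert.hat v k ∧ k ≤ G.pas v) ∨ (y.1 = GVert.hat v (k - 1) ∧ 1 ≤ k - 1)) ∧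
      rkLe (G.pas v) (r' y) (r' (GVert.bar v, m)) := by
  have h₁ := (hr'.of_P1 hx (by simp [GP0]) (y := GVert.tilde v k) ⟨hv, k, hk, hkp, rfl⟩).1
  obtain ⟨hE, h₂, -⟩ := hr'.of_P0 (ne_none_of_rkLe h₁ hx) (by simp [GP0])
  exact ⟨hE.2.2.2, rkLe_trans h₂ h₁⟩

/-- If `(v̂,k)` with `k` even is chosen at `(ṽ,k)`, then all successors of `v` have rank at most
that of `v̄` with respect to `≤_k`. -/
theorem IsGoodRanking.hat_even (hr' : IsGoodRanking (GProdEdge G s u) (fun x => GP0 G x.1)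
      (fun x => GPas G x.1) r') {v : V} {m : M} (hx : r' (GVert.bar v, m) ≠ none)
    (hv : v ∈ G.Vp) {k : ℕ} (hk : Even k) (hkp : k ≤ G.pas v)
    (hs : (s (GVert.tilde v k, u (GVert.bar v, m) (GVert.tilde v k))).1 = GVert.hat v k)
    {w : V} (hw : G.E v w) :
    rkLe k (r' (GLift G w, u (GVert.hat v k,
      (s (GVert.tilde v k, u (GVert.bar v, m) (GVert.tilde v k))).2) (GLift G w)))
      (r' (GVert.bar v, m)) := by
  obtain ⟨-, h₁⟩ := hr'.tilde hx hv hk (by omega)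
  rw [show s (GVert.tilde v k, u (GVert.bar v, m) (GVert.tilde v k)) = (GVert.hat v k,
    (s (GVert.tilde v k, u (GVert.bar v, m) (GVert.tilde v k))).2) from Prod.ext hs rfl] at h₁
  have h₂ := (hr'.of_P1 (ne_none_of_rkLe h₁ hx) (by simpa [GP0] using hk)
    (y := GLift G w) ⟨hv, hkp, w, hw, rfl⟩).1
  exact rkLe_trans h₂ (rkLe_mono (by omega) h₁)

/-- If `(v̂,k-1)` is chosen at `(ṽ,k)`, then the successor of `v` chosen there has rank smaller
than that of `v̄` with respect to `<_{k-1}`. -/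
theorem IsGoodRanking.hat_odd (hr' : IsGoodRanking (GProdEdge G s u) (fun x => GP0 G x.1)
      (fun x => GPas G x.1) r') {v : V} {m : M} (hx : r' (GVert.bar v, m) ≠ none)
    (hv : v ∈ G.Vp) {k : ℕ} (hk : Even k) (hk1 : 1 ≤ k) (hkp : k ≤ G.pas v + 1)
    (hs : (s (GVert.tilde v k, u (GVert.bar v, m) (GVert.tilde v k))).1 =
      GVert.hat v (k - 1)) :
    let c := s (GVert.hat v (k - 1),
      (s (GVert.tilde v k, u (GVert.bar v, m) (GVert.tilde v k))).2)
    ∃ w, G.E v w ∧ c.1 = GLift G w ∧ rkLt (k - 1) (r' c) (r' (GVert.bar v, m)) := by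
  have hodd : Odd (k - 1) := Nat.Even.sub_odd hk1 hk odd_one
  obtain ⟨-, h₁⟩ := hr'.tilde hx hv hk hkp
  rw [show s (GVert.tilde v k, u (GVert.bar v, m) (GVert.tilde v k)) = (GVert.hat v (k - 1),
    (s (GVert.tilde v k, u (GVert.bar v, m) (GVert.tilde v k))).2) from Prod.ext hs rfl] at h₁
  obtain ⟨⟨-, -, w, hw, hc⟩, -, h₂⟩ := hr'.of_P0 (ne_none_of_rkLe h₁ hx) hodd
  exact ⟨w, hw, hc, rkLt_of_rkLt_of_rkLe (h₂ hodd) (rkLe_mono (by omega) h₁)⟩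

theorem vpMem_prob_of_exists (hr' : IsGoodRanking (GProdEdge G s u) (fun x => GP0 G x.1)
      (fun x => GPas G x.1) r') {v : V} {m : M} (hx : r' (GVert.bar v, m) ≠ none)
    (hv : v ∈ G.Vp)
    (h : ∃ i, 1 ≤ i ∧ 2 * i ≤ G.pas v + 1 ∧
      (s (GVert.tilde v (2 * i), u (GVert.bar v, m) (GVert.tilde v (2 * i)))).1 =
        GVert.hat v (2 * i - 1)) :
    ∃ j, Odd j ∧ j ≤ G.pas v ∧
      probLe G (fun x => r' (GLift G x.1, x.2)) (vpMem G s u) (v, m) (j - 2) = 1 ∧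
      minTransProb G ≤
        probLt G (fun x => r' (GLift G x.1, x.2)) (vpMem G s u) (v, m) j := by
  classical
  have hmem : ∀ w, vpMem G s u (v, m) w = _ := fun w => dif_pos h
  obtain ⟨hi1, hip, hsi⟩ := Nat.find_spec h
  have hmin := fun i => Nat.find_min h (m := i)
  generalize hi : Nat.find h = i at hi1 hip hsi hmin
  have hmem' : ∀ w, vpMem G s u (v, m) w =
      if (s (GVert.hat v (2 * i - 1), (s (GVert.tilde v (2 * i),
          u (GVert.bar v, m) (GVert.tilde v (2 * i)))).2)).1 = GLift G w
      then (s (GVert.hat v (2 * i - 1), (s (GVert.tilde v (2 * i),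
          u (GVert.bar v, m) (GVert.tilde v (2 * i)))).2)).2
      else u (GVert.hat v (2 * i - 2), (s (GVert.tilde v (2 * i - 2),
          u (GVert.bar v, m) (GVert.tilde v (2 * i - 2)))).2) (GLift G w) := by
    intro w
    rw [hmem w, ← hi]
  obtain ⟨w₀, hw₀, hc, hlt⟩ := hr'.hat_odd hx hv (even_two_mul i) (by omega) hip hsi
  have hrank : ∀ w, (s (GVert.hat v (2 * i - 1), (s (GVert.tilde v (2 * i),
      u (GVert.bar v, m) (GVert.tilde v (2 * i)))).2)).1 = GLift G w →
      rkLt (2 * i - 1) (r' (GLift G w, vpMem G s u (v, m) w)) (r' (GVert.bar v, m)) := by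
    intro w hw
    rw [hmem' w, if_pos hw, ← hw]
    exact hlt
  refine ⟨2 * i - 1, ⟨i - 1, by omega⟩, by omega, probLe_eq_one hv fun w hw => ?_,
    minTransProb_le_probLt hv hw₀ ?_⟩
  · dsimp only
    rw [GLift_of_mem hv]
    by_cases hcw : (s (GVert.hat v (2 * i - 1), (s (GVert.tilde v (2 * i),
        u (GVert.bar v, m) (GVert.tilde v (2 * i)))).2)).1 = GLift G w
    · exact rkLe_mono (by omega) (rkLe_of_rkLt (hrank w hcw))
    · rw [hmem' w, if_neg hcw]
      have hev : Even (2 * i - 2) := ⟨i - 1, by omega⟩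
      refine rkLe_mono (l := 2 * i - 2) (by omega)
        (hr'.hat_even hx hv hev (by omega) ?_ hw)
      rcases (hr'.tilde hx hv hev (by omega)).1 with ⟨h₁, -⟩ | ⟨h₁, h₂⟩
      · exact h₁
      · refine absurd ⟨by omega, by omega, ?_⟩ (hmin (i - 1) (by omega))
        rwa [show 2 * (i - 1) = 2 * i - 2 by omega]
  · dsimp only
    rw [GLift_of_mem hv]
    exact hrank w₀ hc

theorem vpMem_probLe_of_not_exists (hr' : IsGoodRanking (GProdEdge G s u)
      (fun x => GP0 G x.1) (fun x => GPas G x.1) r') {v : V} {m : M}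
    (hx : r' (GVert.bar v, m) ≠ none) (hv : v ∈ G.Vp) (hp : Even (G.pas v))
    (h : ¬ ∃ i, 1 ≤ i ∧ 2 * i ≤ G.pas v + 1 ∧
      (s (GVert.tilde v (2 * i), u (GVert.bar v, m) (GVert.tilde v (2 * i)))).1 =
        GVert.hat v (2 * i - 1)) :
    probLe G (fun x => r' (GLift G x.1, x.2)) (vpMem G s u) (v, m) (G.pas v - 1) = 1 := by
  refine probLe_eq_one hv fun w hw => ?_
  dsimp only
  rw [GLift_of_mem hv, show vpMem G s u (v, m) w = _ from dif_neg h]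
  obtain ⟨i, hi⟩ := hp
  refine rkLe_mono (l := G.pas v) (by omega) (hr'.hat_even hx hv ⟨i, hi⟩ le_rfl ?_ hw)
  rcases (hr'.tilde hx hv ⟨i, hi⟩ (by omega)).1 with ⟨h₁, -⟩ | ⟨h₁, h₂⟩
  · exact h₁
  · refine absurd ⟨i, by omega, by omega, ?_⟩ h
    rwa [show 2 * i = G.pas v by omega]

theorem exists_odd_choice_of_odd (hr' : IsGoodRanking (GProdEdge G s u)
      (fun x => GP0 G x.1) (fun x => GPas G x.1) r') {v : V} {m : M}
    (hx : r' (GVert.bar v, m) ≠ none) (hv : v ∈ G.Vp) (hp : Odd (G.pas v)) :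
    ∃ i, 1 ≤ i ∧ 2 * i ≤ G.pas v + 1 ∧
      (s (GVert.tilde v (2 * i), u (GVert.bar v, m) (GVert.tilde v (2 * i)))).1 =
        GVert.hat v (2 * i - 1) := by
  obtain ⟨i, hi⟩ := hp
  refine ⟨i + 1, by omega, by omega, ?_⟩
  rcases (hr'.tilde hx hv (even_two_mul (i + 1)) (by omega)).1 with ⟨-, h₁⟩ | ⟨h₁, -⟩
  · omega
  · exact h₁

end GoodRanking

/-- every good parity ranking (with respect to `p'_as`) of
`G' × M` induces an almost-sure ranking (with respect to `p_as`) of `G × M`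
(where Player-0 choices are fixed by the strategy induced from the finite-memory
strategy `(s, u)` via the gadget structure), the rank of a configuration `(v, m)`
of `G × M` being the rank of its matching configuration of `G' × M`, and `ε`
being the minimal probability of a transition in `G`. -/
theorem good_ranking_induces_as_ranking (G : SASGame V)
    (s : GVert V × M → GVert V × M) (u : GVert V × M → GVert V → M)
    (hs : ∀ x, GP0 G x.1 → (∃ z, GEdge G x.1 z) → GEdge G x.1 (s x).1)
    (r' : GVert V × M → Option (ℕ → ℕ))
    (hr' : IsGoodRanking (GProdEdge G s u) (fun x => GP0 G x.1)
      (fun x => GPas G x.1) r') :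
    IsASRanking G (succ0of G s) (mem1of G u) (vpMem G s u)
      (fun x => r' (GLift G x.1, x.2)) (minTransProb G) := by
  intro x hx
  obtain ⟨v, m⟩ := x
  dsimp only at hx ⊢
  refine ⟨fun hv => ?_, fun hv w hw => ?_, fun hv hp => ?_, fun hv hp => ?_⟩
  · have hvp : v ∉ G.Vp := Set.disjoint_left.mp G.disj0p hv
    rw [GLift_of_notMem hvp] at hx ⊢
    obtain ⟨⟨-, w, -, hw⟩, h⟩ := hr'.of_P0 hx (show GP0 G (GVert.base v) from hv)
    refine ⟨_, rfl, ?_⟩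
    have : (GLift G (s (GVert.base v, m)).1.unlift, (s (GVert.base v, m)).2) =
        s (GVert.base v, m) := Prod.ext (by rw [hw, unlift_GLift]) rfl
    rw [this]
    exact h
  · have hvp : v ∉ G.Vp := Set.disjoint_left.mp G.disj1p hv
    rw [GLift_of_notMem hvp] at hx ⊢
    exact hr'.of_P1 hx (show ¬ GP0 G (GVert.base v) from Set.disjoint_right.mp G.disj01 hv)
      ⟨Or.inr hv, w, hw, rfl⟩
  · rw [GLift_of_mem hv] at hx
    by_cases h : ∃ i, 1 ≤ i ∧ 2 * i ≤ G.pas v + 1 ∧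
      (s (GVert.tilde v (2 * i), u (GVert.bar v, m) (GVert.tilde v (2 * i)))).1 =
        GVert.hat v (2 * i - 1)
    · exact Or.inr (vpMem_prob_of_exists hr' hx hv h)
    · exact Or.inl (vpMem_probLe_of_not_exists hr' hx hv hp h)
  · rw [GLift_of_mem hv] at hx
    exact vpMem_prob_of_exists hr' hx hv (exists_odd_choice_of_odd hr' hx hv hp)
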